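/- Let n₁, n₂ ≥ 1, n = n₁n₂, and let M be the Moore–Penrose pseudoinverse of the two-dimensional discrete periodic divergence div (so M maps images to pairs of fields). Then for every image y: (i) div(M y) = y − ȳ𝟙, and (ii) the solution set {(v, w) : div(v, w) = y − ȳ𝟙} equals {M y + ζ : ζ ∈ ker div}. -/

import Mathlib

/-- Discrete periodic divergence in 2D as a linear map from pairs of fields to images:
`(div (v, w))_{i,j} = v_{i-1,j} - v_{i,j} + w_{i,j-1} - w_{i,j}`. -/
noncomputable def div2L (n₁ n₂ : ℕ) :
    ((ZMod n₁ × ZMod n₂ → ℝ) × (ZMod n₁ × ZMod n₂ → ℝ)) →ₗ[ℝ]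
      (ZMod n₁ × ZMod n₂ → ℝ) where
  toFun vw := fun p => vw.1 (p.1 - 1, p.2) - vw.1 p + (vw.2 (p.1, p.2 - 1) - vw.2 p)
  map_add' a b := by
    funext p
    simp only [Prod.fst_add, Prod.snd_add, Pi.add_apply]
    ring
  map_smul' c a := by
    funext p
    simp only [Prod.smul_fst, Prod.smul_snd, Pi.smul_apply, smul_eq_mul, RingHom.id_apply]
    ring

/-- Standard inner product on images. -/
noncomputable def dotIm (n₁ n₂ : ℕ) [NeZero n₁] [NeZero n₂]
    (u v : ZMod n₁ × ZMod n₂ → ℝ) : ℝ := ∑ p, u p * v p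

/-- Standard inner product on pairs of fields. -/
noncomputable def dotPair (n₁ n₂ : ℕ) [NeZero n₁] [NeZero n₂]
    (a b : (ZMod n₁ × ZMod n₂ → ℝ) × (ZMod n₁ × ZMod n₂ → ℝ)) : ℝ :=
  ∑ p, (a.1 p * b.1 p + a.2 p * b.2 p)

/-- Mean of an image indexed by `ZMod n₁ × ZMod n₂`. -/
noncomputable def mean2 (n₁ n₂ : ℕ) [NeZero n₁] [NeZero n₂]
    (y : ZMod n₁ × ZMod n₂ → ℝ) : ℝ :=
  (∑ p, y p) / (n₁ * n₂)

theorem aux_shift1 (n₁ n₂ : ℕ) [NeZero n₁] [NeZero n₂] (f : ZMod n₁ × ZMod n₂ → ℝ) :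
    ∑ p : ZMod n₁ × ZMod n₂, f (p.1 - 1, p.2) = ∑ p, f p :=
  Equiv.sum_comp (Equiv.prodCongr (Equiv.subRight (1 : ZMod n₁)) (Equiv.refl (ZMod n₂))) f

theorem aux_shift2 (n₁ n₂ : ℕ) [NeZero n₁] [NeZero n₂] (f : ZMod n₁ × ZMod n₂ → ℝ) :
    ∑ p : ZMod n₁ × ZMod n₂, f (p.1, p.2 - 1) = ∑ p, f p :=
  Equiv.sum_comp (Equiv.prodCongr (Equiv.refl (ZMod n₁)) (Equiv.subRight (1 : ZMod n₂))) f

theorem aux_sum_div (n₁ n₂ : ℕ) [NeZero n₁] [NeZero n₂]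
    (x : (ZMod n₁ × ZMod n₂ → ℝ) × (ZMod n₁ × ZMod n₂ → ℝ)) :
    ∑ p, div2L n₁ n₂ x p = 0 := by
  change ∑ p : ZMod n₁ × ZMod n₂,
    (x.1 (p.1 - 1, p.2) - x.1 p + (x.2 (p.1, p.2 - 1) - x.2 p)) = 0
  rw [Finset.sum_add_distrib, Finset.sum_sub_distrib, Finset.sum_sub_distrib,
    aux_shift1, aux_shift2]
  ring

/-- An image orthogonal to the range of the divergence is constant. -/
theorem aux_const (n₁ n₂ : ℕ) [NeZero n₁] [NeZero n₂] (r : ZMod n₁ × ZMod n₂ → ℝ)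
    (h : ∀ x, dotIm n₁ n₂ r (div2L n₁ n₂ x) = 0) (p : ZMod n₁ × ZMod n₂) :
    r p = r (0, 0) := by
  have hv : ∀ v : ZMod n₁ × ZMod n₂ → ℝ, ∑ p, (r (p.1 + 1, p.2) - r p) * v p = 0 := by
    intro v
    have h0 := h (v, 0)
    have hs := aux_shift1 n₁ n₂ (fun p => r (p.1 + 1, p.2) * v p)
    simp only [sub_add_cancel] at hs
    have e : dotIm n₁ n₂ r (div2L n₁ n₂ (v, 0))
        = ∑ p : ZMod n₁ × ZMod n₂, (r p * v (p.1 - 1, p.2) - r p * v p) := by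
      simp [dotIm, div2L, mul_sub]
    rw [e, Finset.sum_sub_distrib] at h0
    simp only [sub_mul, Finset.sum_sub_distrib]
    rw [← hs]
    exact h0
  have hw : ∀ v : ZMod n₁ × ZMod n₂ → ℝ, ∑ p, (r (p.1, p.2 + 1) - r p) * v p = 0 := by
    intro v
    have h0 := h (0, v)
    have hs := aux_shift2 n₁ n₂ (fun p => r (p.1, p.2 + 1) * v p)
    simp only [sub_add_cancel] at hs
    have e : dotIm n₁ n₂ r (div2L n₁ n₂ (0, v))
        = ∑ p : ZMod n₁ × ZMod n₂, (r p * v (p.1, p.2 - 1) - r p * v p) := by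
      simp [dotIm, div2L, mul_sub]
    rw [e, Finset.sum_sub_distrib] at h0
    simp only [sub_mul, Finset.sum_sub_distrib]
    rw [← hs]
    exact h0
  have s1 : ∀ a b, r (a + 1, b) = r (a, b) := by
    intro a b
    have := (Finset.sum_eq_zero_iff_of_nonneg (fun i _ => mul_self_nonneg _)).1
      (hv (fun p => r (p.1 + 1, p.2) - r p)) (a, b) (Finset.mem_univ _)
    exact sub_eq_zero.1 (mul_self_eq_zero.1 this)
  have s2 : ∀ a b, r (a, b + 1) = r (a, b) := by
    intro a b
    have := (Finset.sum_eq_zero_iff_of_nonneg (fun i _ => mul_self_nonneg _)).1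
      (hw (fun p => r (p.1, p.2 + 1) - r p)) (a, b) (Finset.mem_univ _)
    exact sub_eq_zero.1 (mul_self_eq_zero.1 this)
  have t1 : ∀ (k : ℕ) b, r ((k : ZMod n₁), b) = r (0, b) := by
    intro k b
    induction k with
    | zero => simp
    | succ k ih => rw [Nat.cast_succ, s1, ih]
  have t2 : ∀ (k : ℕ) a, r (a, (k : ZMod n₂)) = r (a, 0) := by
    intro k a
    induction k with
    | zero => simp
    | succ k ih => rw [Nat.cast_succ, s2, ih]
  obtain ⟨a, b⟩ := p
  rw [← ZMod.natCast_zmod_val a, ← ZMod.natCast_zmod_val b, t1, t2]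

theorem stmt9 (n₁ n₂ : ℕ) [NeZero n₁] [NeZero n₂] (hn₁ : 1 ≤ n₁) (hn₂ : 1 ≤ n₂)
    (M : (ZMod n₁ × ZMod n₂ → ℝ) →ₗ[ℝ]
      ((ZMod n₁ × ZMod n₂ → ℝ) × (ZMod n₁ × ZMod n₂ → ℝ)))
    (h1 : div2L n₁ n₂ ∘ₗ M ∘ₗ div2L n₁ n₂ = div2L n₁ n₂)
    (h2 : M ∘ₗ div2L n₁ n₂ ∘ₗ M = M)
    (h3 : ∀ u v : ZMod n₁ × ZMod n₂ → ℝ,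
      dotIm n₁ n₂ (div2L n₁ n₂ (M u)) v = dotIm n₁ n₂ u (div2L n₁ n₂ (M v)))
    (h4 : ∀ a b : (ZMod n₁ × ZMod n₂ → ℝ) × (ZMod n₁ × ZMod n₂ → ℝ),
      dotPair n₁ n₂ (M (div2L n₁ n₂ a)) b = dotPair n₁ n₂ a (M (div2L n₁ n₂ b))) :
    ∀ y : ZMod n₁ × ZMod n₂ → ℝ,
      div2L n₁ n₂ (M y) = (fun p => y p - mean2 n₁ n₂ y) ∧
        {vw : (ZMod n₁ × ZMod n₂ → ℝ) × (ZMod n₁ × ZMod n₂ → ℝ) |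
            div2L n₁ n₂ vw = fun p => y p - mean2 n₁ n₂ y} =
          {vw | ∃ ζ ∈ LinearMap.ker (div2L n₁ n₂), vw = M y + ζ} := by
  intro y
  have key : div2L n₁ n₂ (M y) = (fun p => y p - mean2 n₁ n₂ y) := by
    have horth : ∀ x, dotIm n₁ n₂ (y - div2L n₁ n₂ (M y)) (div2L n₁ n₂ x) = 0 := by
      intro x
      have e := h3 y (div2L n₁ n₂ x)
      have e1 : div2L n₁ n₂ (M (div2L n₁ n₂ x)) = div2L n₁ n₂ x := LinearMap.congr_fun h1 x
      rw [e1] at e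
      simp only [dotIm] at e ⊢
      simp only [Pi.sub_apply, sub_mul, Finset.sum_sub_distrib]
      rw [e, sub_self]
    have hc := aux_const n₁ n₂ _ horth
    generalize (y - div2L n₁ n₂ (M y)) (0, 0) = c at hc
    have hsum : ∑ p, y p = (n₁ * n₂ : ℝ) * c := by
      have e : ∑ p, (y - div2L n₁ n₂ (M y)) p = ∑ p, y p := by
        simp only [Pi.sub_apply, Finset.sum_sub_distrib, aux_sum_div, sub_zero]
      rw [← e, Finset.sum_congr rfl (fun p _ => hc p)]
      simp [ZMod.card]
    have hm : mean2 n₁ n₂ y = c := by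
      have a1 : (n₁ : ℝ) ≠ 0 := Nat.cast_ne_zero.2 (NeZero.ne n₁)
      have a2 : (n₂ : ℝ) ≠ 0 := Nat.cast_ne_zero.2 (NeZero.ne n₂)
      rw [mean2, hsum]
      field_simp
    funext p
    have := hc p
    rw [Pi.sub_apply] at this
    rw [hm]
    linarith
  refine ⟨key, ?_⟩
  ext vw
  simp only [Set.mem_setOf_eq]
  rw [← key]
  constructor
  · intro h
    exact ⟨vw - M y, by rw [LinearMap.mem_ker, map_sub, h, sub_self], by abel⟩
  · rintro ⟨ζ, hζ, rfl⟩
    rw [map_add, LinearMap.mem_ker.1 hζ, add_zero]
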